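/- Let U be a linearly ordered type, let f : U → ℕ, and for each finite nonempty A ⊆ U let m(A) denote the least element y ∈ A such that f(y) = min_{x ∈ A} f(x). Then for all finite nonempty S, T ⊆ U: m(S) = m(T) if and only if m(S ∪ T) ∈ S ∩ T. -/

import Mathlib

/-- The min-hash of a nonempty finite set `A` under `f`: the least element of `A`
attaining the minimum of `f` on `A`. -/
noncomputable def minHash {U : Type*} [LinearOrder U] (f : U → ℕ) (A : Finset U)
    (h : A.Nonempty) : U :=
  (A.filter fun y => f y = A.inf' h f).min' (by
    obtain ⟨y, hy, hfy⟩ := Finset.exists_mem_eq_inf' h f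
    exact ⟨y, Finset.mem_filter.2 ⟨hy, hfy.symm⟩⟩)

/-- The min-hash is the unique element minimizing `x ↦ (f x, x)` lexicographically. -/
theorem minHash_eq_iff {U : Type*} [LinearOrder U] (f : U → ℕ) {A : Finset U}
    (h : A.Nonempty) {y : U} :
    minHash f A h = y ↔ y ∈ A ∧ ∀ x ∈ A, toLex (f y, y) ≤ toLex (f x, x) := by
  have hmem : minHash f A h ∈ A.filter fun y => f y = A.inf' h f := Finset.min'_mem _ _
  obtain ⟨hA, hf⟩ := Finset.mem_filter.1 hmem
  have hle : ∀ x ∈ A, toLex (f (minHash f A h), minHash f A h) ≤ toLex (f x, x) := by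
    intro x hx
    have hfx : f (minHash f A h) ≤ f x := hf.trans_le (Finset.inf'_le f hx)
    refine Prod.Lex.toLex_le_toLex.2 (hfx.lt_or_eq.imp_right fun heq => ⟨heq, ?_⟩)
    exact Finset.min'_le _ _ (Finset.mem_filter.2 ⟨hx, heq.symm.trans hf⟩)
  refine ⟨?_, fun ⟨hy, hmin⟩ => ?_⟩
  · rintro rfl
    exact ⟨hA, hle⟩
  · exact congrArg (fun p => (ofLex p).2) ((hle y hy).antisymm (hmin _ hA))

/-- Two finite nonempty sets have the same min-hash iff the min-hash of their union
lies in their intersection. -/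
theorem stmt14 {U : Type*} [LinearOrder U] (f : U → ℕ) (S T : Finset U)
    (hS : S.Nonempty) (hT : T.Nonempty) :
    minHash f S hS = minHash f T hT ↔
      minHash f (S ∪ T) (hS.mono Finset.subset_union_left) ∈ S ∩ T := by
  have hU := hS.mono (Finset.subset_union_left (s₂ := T))
  constructor
  · intro heq
    obtain ⟨hmS, hleS⟩ := (minHash_eq_iff f hS).1 heq
    obtain ⟨hmT, hleT⟩ := (minHash_eq_iff f hT).1 rfl
    rw [(minHash_eq_iff f hU).2 ⟨Finset.mem_union_left T hmS, fun x hx =>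
      (Finset.mem_union.1 hx).elim (hleS x) (hleT x)⟩]
    exact Finset.mem_inter.2 ⟨hmS, hmT⟩
  · intro hm
    obtain ⟨hmS, hmT⟩ := Finset.mem_inter.1 hm
    have hle := ((minHash_eq_iff f hU).1 rfl).2
    rw [(minHash_eq_iff f hS).2 ⟨hmS, fun x hx => hle x (Finset.mem_union_left T hx)⟩,
      (minHash_eq_iff f hT).2 ⟨hmT, fun x hx => hle x (Finset.mem_union_right S hx)⟩]
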